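/- arXiv:2211.05519 — 3 statements merged into one kernel-verified Lean document; each statement's English description precedes it below -/
import Mathlib

section
/- Let A be a ring and Ã = [[A,0],[S̄,Ā]] its asymmetric cover, with right Ã-module decomposition Ã = P ⊕ Q where P = eÃ and Q = fÃ. Then the socle of the right Ã-module Q decomposes as soc Q = S̄ ⊕ soc Ā, and this is isomorphic as a right Ã-module to the direct sum over S ∈ Σ(A) of S ⊕ End_A(S)^♮, where End_A(S)^♮ denotes the square-zero ideal of T(End_A(S)) viewed as a simple Ã-module. -/
set_option linter.unusedSectionVars false
set_option synthInstance.maxHeartbeats 1000000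
set_option maxHeartbeats 1600000
set_option linter.unusedVariables false
set_option linter.unnecessarySeqFocus false

universe u
open MulOpposite Function DirectSum

/-! ### Lower triangular matrix rings -/

/-- The lower triangular matrix ring `[[A,0],[M,B]]` for a `B`-`A`-bimodule `M`
(a left `B`-module with a commuting right `A`-action, the latter written as a
left `Aᵐᵒᵖ`-action). The element `⟨a, m, b⟩` represents the matrix `[[a,0],[m,b]]`. -/
@[ext] structure Tri (A B M : Type u) : Type u where
  a : A
  m : M
  b : B

namespace Tri
variable {A B M : Type u} [Ring A] [Ring B] [AddCommGroup M]
  [Module B M] [Module Aᵐᵒᵖ M] [SMulCommClass B Aᵐᵒᵖ M]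

instance : Zero (Tri A B M) := ⟨⟨0, 0, 0⟩⟩
instance : Add (Tri A B M) := ⟨fun x y => ⟨x.a + y.a, x.m + y.m, x.b + y.b⟩⟩
instance : Neg (Tri A B M) := ⟨fun x => ⟨-x.a, -x.m, -x.b⟩⟩
instance : One (Tri A B M) := ⟨⟨1, 0, 1⟩⟩
instance : Mul (Tri A B M) :=
  ⟨fun x y => ⟨x.a * y.a, op y.a • x.m + x.b • y.m, x.b * y.b⟩⟩

@[simp] lemma zero_a : (0 : Tri A B M).a = 0 := rfl
@[simp] lemma zero_m : (0 : Tri A B M).m = 0 := rfl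
@[simp] lemma zero_b : (0 : Tri A B M).b = 0 := rfl
@[simp] lemma add_a (x y : Tri A B M) : (x + y).a = x.a + y.a := rfl
@[simp] lemma add_m (x y : Tri A B M) : (x + y).m = x.m + y.m := rfl
@[simp] lemma add_b (x y : Tri A B M) : (x + y).b = x.b + y.b := rfl
@[simp] lemma neg_a (x : Tri A B M) : (-x).a = -x.a := rfl
@[simp] lemma neg_m (x : Tri A B M) : (-x).m = -x.m := rfl
@[simp] lemma neg_b (x : Tri A B M) : (-x).b = -x.b := rfl
@[simp] lemma one_a : (1 : Tri A B M).a = 1 := rfl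
@[simp] lemma one_m : (1 : Tri A B M).m = 0 := rfl
@[simp] lemma one_b : (1 : Tri A B M).b = 1 := rfl
@[simp] lemma mul_a (x y : Tri A B M) : (x * y).a = x.a * y.a := rfl
@[simp] lemma mul_m (x y : Tri A B M) : (x * y).m = op y.a • x.m + x.b • y.m := rfl
@[simp] lemma mul_b (x y : Tri A B M) : (x * y).b = x.b * y.b := rfl

instance : AddCommGroup (Tri A B M) where
  add_assoc x y z := by ext <;> simp [add_assoc]
  zero_add x := by ext <;> simp
  add_zero x := by ext <;> simp
  add_comm x y := by ext <;> simp [add_comm]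
  neg_add_cancel x := by ext <;> simp
  nsmul := nsmulRec
  zsmul := zsmulRec

instance : Ring (Tri A B M) :=
  { (inferInstance : AddCommGroup (Tri A B M)),
    (inferInstance : Mul (Tri A B M)),
    (inferInstance : One (Tri A B M)) with
    left_distrib := fun x y z => by
      ext <;> simp [mul_add, smul_add, add_smul] <;> abel
    right_distrib := fun x y z => by
      ext <;> simp [add_mul, smul_add, add_smul] <;> abel
    zero_mul := fun x => by ext <;> simp
    mul_zero := fun x => by ext <;> simp
    mul_assoc := fun x y z => by
      refine Tri.ext (mul_assoc _ _ _) ?_ (mul_assoc _ _ _)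
      simp only [mul_m, mul_b, mul_a, smul_add, op_mul, mul_smul]
      rw [smul_comm x.b (op z.a) y.m]
      abel
    one_mul := fun x => by ext <;> simp
    mul_one := fun x => by ext <;> simp }

end Tri

/-! ### Corner rings -/

/-- The corner ring `eΛe` of a ring `Λ` at an idempotent `e`, with unit `e`. -/
def Corner {Λ : Type u} [Ring Λ] (e : Λ) (_ : IsIdempotentElem e) : Type u :=
  {x : Λ // e * x = x ∧ x * e = x}

namespace Corner
variable {Λ : Type u} [Ring Λ] {e : Λ} {he : IsIdempotentElem e}

instance : Zero (Corner e he) := ⟨⟨0, by simp, by simp⟩⟩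
instance : Add (Corner e he) :=
  ⟨fun x y => ⟨x.1 + y.1, by rw [mul_add, x.2.1, y.2.1], by rw [add_mul, x.2.2, y.2.2]⟩⟩
instance : Neg (Corner e he) :=
  ⟨fun x => ⟨-x.1, by rw [mul_neg, x.2.1], by rw [neg_mul, x.2.2]⟩⟩
instance : Mul (Corner e he) :=
  ⟨fun x y => ⟨x.1 * y.1, by rw [← mul_assoc, x.2.1], by rw [mul_assoc, y.2.2]⟩⟩
instance : One (Corner e he) := ⟨⟨e, he, he⟩⟩

instance : Ring (Corner e he) where
  add_assoc x y z := Subtype.ext (add_assoc _ _ _)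
  zero_add x := Subtype.ext (zero_add _)
  add_zero x := Subtype.ext (add_zero _)
  add_comm x y := Subtype.ext (add_comm _ _)
  neg_add_cancel x := Subtype.ext (neg_add_cancel _)
  nsmul := nsmulRec
  zsmul := zsmulRec
  left_distrib x y z := Subtype.ext (mul_add _ _ _)
  right_distrib x y z := Subtype.ext (add_mul _ _ _)
  zero_mul x := Subtype.ext (zero_mul _)
  mul_zero x := Subtype.ext (mul_zero _)
  mul_assoc x y z := Subtype.ext (mul_assoc _ _ _)
  one_mul x := Subtype.ext x.2.1
  mul_one x := Subtype.ext x.2.2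

end Corner

/-! ### Projective dimension and finitistic dimensions -/

/-- `pdLE R n M` : `M` has projective dimension at most `n` as a left `R`-module. -/
def pdLE (R : Type u) [Ring R] : (n : ℕ) → (M : Type u) → [AddCommGroup M] → [Module R M] → Prop
  | 0, M, _, _ => Module.Projective R M
  | n+1, M, _, _ => ∃ (P : Type u) (_ : AddCommGroup P) (_ : Module R P),
      Module.Projective R P ∧
      ∃ f : P →ₗ[R] M, Function.Surjective f ∧ pdLE R n (LinearMap.ker f)

/-- The projective dimension of a left `R`-module, as an element of `ℕ∞`
(with value `⊤` when no finite projective resolution exists). -/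
noncomputable def projDim (R : Type u) [Ring R] (M : Type u) [AddCommGroup M] [Module R M] : ℕ∞ :=
  sInf {d : ℕ∞ | ∃ n : ℕ, d = n ∧ pdLE R n M}

/-- `fgpdLE R n M` : `M` admits a resolution of length at most `n` by finitely
generated projective left `R`-modules. -/
def fgpdLE (R : Type u) [Ring R] :
    (n : ℕ) → (M : Type u) → [AddCommGroup M] → [Module R M] → Prop
  | 0, M, _, _ => Module.Projective R M ∧ Module.Finite R M
  | n+1, M, _, _ => ∃ (P : Type u) (_ : AddCommGroup P) (_ : Module R P),
      (Module.Projective R P ∧ Module.Finite R P) ∧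
      ∃ f : P →ₗ[R] M, Function.Surjective f ∧ fgpdLE R n (LinearMap.ker f)

/-- The small finitistic dimension of `R`, computed with *left* `R`-modules: the
supremum of the projective dimensions of the left modules admitting a finite
resolution by finitely generated projectives. -/
noncomputable def smallFinDimLeft (R : Type u) [Ring R] : ℕ∞ :=
  sSup {d : ℕ∞ | ∃ (M : Type u) (_ : AddCommGroup M) (_ : Module R M),
    (∃ n : ℕ, fgpdLE R n M) ∧ projDim R M = d}

/-- The big finitistic dimension of `R`, computed with *left* `R`-modules: the
supremum of all finite projective dimensions of left `R`-modules. -/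
noncomputable def bigFinDimLeft (R : Type u) [Ring R] : ℕ∞ :=
  sSup {d : ℕ∞ | d ≠ ⊤ ∧ ∃ (M : Type u) (_ : AddCommGroup M) (_ : Module R M),
    projDim R M = d}

/-- `fin.dim R` : the small finitistic dimension of `R`, computed with right
`R`-modules (= left `Rᵐᵒᵖ`-modules). -/
noncomputable def finDim (R : Type u) [Ring R] : ℕ∞ := smallFinDimLeft Rᵐᵒᵖ

/-- `Fin.dim R` : the big finitistic dimension of `R`, computed with right
`R`-modules (= left `Rᵐᵒᵖ`-modules). -/
noncomputable def bigFinDim (R : Type u) [Ring R] : ℕ∞ := bigFinDimLeft Rᵐᵒᵖ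

/-! ### Radical, socle, perfect and semilocal rings, Morita equivalence -/

/-- The radical of a module: the intersection of all maximal submodules. -/
def moduleRad (R M : Type u) [Ring R] [AddCommGroup M] [Module R M] : Submodule R M :=
  sInf {N : Submodule R M | IsCoatom N}

/-- The socle of a module: the sum of all simple submodules. -/
def moduleSoc (R M : Type u) [Ring R] [AddCommGroup M] [Module R M] : Submodule R M :=
  sSup {N : Submodule R M | IsSimpleModule R ↥N}

/-- A ring is right perfect if every right module has a projective cover,
i.e. a superfluous epimorphism from a projective module. -/
def IsRightPerfect (R : Type u) [Ring R] : Prop :=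
  ∀ (M : Type u) (_ : AddCommGroup M) (_ : Module Rᵐᵒᵖ M),
    ∃ (P : Type u) (_ : AddCommGroup P) (_ : Module Rᵐᵒᵖ P) (f : P →ₗ[Rᵐᵒᵖ] M),
      Module.Projective Rᵐᵒᵖ P ∧ Function.Surjective f ∧
      ∀ N : Submodule Rᵐᵒᵖ P, N ⊔ LinearMap.ker f = ⊤ → N = ⊤

/-- A ring is left perfect if every left module has a projective cover. -/
def IsLeftPerfect (R : Type u) [Ring R] : Prop :=
  ∀ (M : Type u) (_ : AddCommGroup M) (_ : Module R M),
    ∃ (P : Type u) (_ : AddCommGroup P) (_ : Module R P) (f : P →ₗ[R] M),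
      Module.Projective R P ∧ Function.Surjective f ∧
      ∀ N : Submodule R P, N ⊔ LinearMap.ker f = ⊤ → N = ⊤

/-- A ring is semilocal if its quotient by the Jacobson radical is semisimple;
equivalently, there is a surjective ring homomorphism onto a semisimple ring
whose kernel is the Jacobson radical. -/
def IsSemilocal (A : Type u) [Ring A] : Prop :=
  ∃ (T : Type u) (_ : Ring T) (f : A →+* T), Function.Surjective f ∧
    IsSemisimpleRing T ∧ RingHom.ker f = (⊥ : Ideal A).jacobson

/-- Morita equivalence, via the categories of right modules. -/
def MoritaEquiv (R S : Type u) [Ring R] [Ring S] : Prop :=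
  Nonempty (ModuleCat.{u} Rᵐᵒᵖ ≌ ModuleCat.{u} Sᵐᵒᵖ)

/-- Powers of an additive subgroup of a ring (e.g. of the Jacobson radical of a
not necessarily commutative ring), defined via products. -/
def addSubgroupPow {R : Type u} [Ring R] (I : AddSubgroup R) : ℕ → AddSubgroup R
  | 0 => ⊤
  | 1 => I
  | n+2 => AddSubgroup.closure {x : R | ∃ p ∈ I, ∃ q ∈ addSubgroupPow I (n+1), x = p * q}

/-- Left multiplication by a fixed element, as an endomorphism of the right
regular module. -/
def leftMulHom (R : Type u) [Ring R] (z : R) : R →ₗ[Rᵐᵒᵖ] R where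
  toFun x := z * x
  map_add' := mul_add z
  map_smul' r x := (mul_assoc z x r.unop).symm

/-! ### The asymmetric cover -/

/-- The endomorphism ring of the right `A`-module `S i`. -/
abbrev EndS (A : Type u) [Ring A] {ι : Type u} (S : ι → Type u)
    [∀ i, AddCommGroup (S i)] [∀ i, Module Aᵐᵒᵖ (S i)] (i : ι) : Type u :=
  Module.End Aᵐᵒᵖ (S i)

/-- `Ā = ∏_{S ∈ Σ(A)} T(End_A(S))`, the product over the simple right `A`-modules
of the trivial extensions of their endomorphism rings. -/
abbrev Abar (A : Type u) [Ring A] {ι : Type u} (S : ι → Type u)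
    [∀ i, AddCommGroup (S i)] [∀ i, Module Aᵐᵒᵖ (S i)] : Type u :=
  ∀ i, TrivSqZeroExt (EndS A S i) (EndS A S i)

/-- `S̄ = ⊕_{S ∈ Σ(A)} S`, the direct sum of the simple right `A`-modules. -/
abbrev Sbar (A : Type u) [Ring A] {ι : Type u} (S : ι → Type u)
    [∀ i, AddCommGroup (S i)] [∀ i, Module Aᵐᵒᵖ (S i)] : Type u :=
  ⨁ i, S i

/-- The canonical projection `T(B) → B` from a trivial extension, as a ring
homomorphism. -/
def tszeFst (B : Type u) [Ring B] : TrivSqZeroExt B B →+* B where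
  toFun x := x.fst
  map_one' := rfl
  map_mul' _ _ := rfl
  map_zero' := rfl
  map_add' _ _ := rfl

section
variable (A : Type u) [Ring A] {ι : Type u} (S : ι → Type u)
  [∀ i, AddCommGroup (S i)] [∀ i, Module Aᵐᵒᵖ (S i)]

/-- The left `Ā`-action on each simple module `S i`, via `Ā → T(End_A(S i)) → End_A(S i)`. -/
instance instModuleAbarS (i : ι) : Module (Abar A S) (S i) where
  smul r x := (r i).fst x
  one_smul x := rfl
  mul_smul r s x := rfl
  smul_zero r := map_zero _
  smul_add r x y := map_add _ x y
  add_smul r s x := LinearMap.add_apply _ _ _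
  zero_smul x := rfl

lemma abar_smul_def (r : Abar A S) (i : ι) (x : S i) : r • x = (r i).fst x := rfl

instance instSMulCommAbarS (i : ι) : SMulCommClass (Abar A S) Aᵐᵒᵖ (S i) where
  smul_comm r a x := map_smul ((r i).fst) a x

instance instSMulCommAbarSbar : SMulCommClass (Abar A S) Aᵐᵒᵖ (Sbar A S) where
  smul_comm r a x := by
    refine DFinsupp.ext fun i => ?_
    change r • (a • x i) = a • (r • x i)
    exact smul_comm _ _ _

end

/-- The asymmetric cover `Ã = [[A,0],[S̄,Ā]]` of the ring `A`, relative to a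
family `S : ι → Type u` of representatives of the simple right `A`-modules. -/
abbrev AsymCover (A : Type u) [Ring A] {ι : Type u} (S : ι → Type u)
    [∀ i, AddCommGroup (S i)] [∀ i, Module Aᵐᵒᵖ (S i)] : Type u :=
  Tri A (Abar A S) (Sbar A S)

/-- `S : ι → Type u` is a complete irredundant family of representatives of the
isomorphism classes of simple right `A`-modules. -/
def IsSimpleFamily (A : Type u) [Ring A] {ι : Type u} (S : ι → Type u)
    [∀ i, AddCommGroup (S i)] [∀ i, Module Aᵐᵒᵖ (S i)] : Prop :=
  (∀ i, IsSimpleModule Aᵐᵒᵖ (S i)) ∧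
  (∀ (T : Type u) (_ : AddCommGroup T) (_ : Module Aᵐᵒᵖ T),
    IsSimpleModule Aᵐᵒᵖ T → ∃ i, Nonempty (T ≃ₗ[Aᵐᵒᵖ] S i)) ∧
  (∀ i j, Nonempty (S i ≃ₗ[Aᵐᵒᵖ] S j) → i = j)

section Statement2
variable (A : Type u) [Ring A] {ι : Type u} (S : ι → Type u)
  [∀ i, AddCommGroup (S i)] [∀ i, Module Aᵐᵒᵖ (S i)]

/-- The right ideal `Q = fÃ` of the asymmetric cover `Ã`, where
`f = [[0,0],[0,1]]`; concretely it consists of the matrices with vanishing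
`(1,1)`-entry. -/
def Qsub : Submodule (AsymCover A S)ᵐᵒᵖ (AsymCover A S) where
  carrier := {x | x.a = 0}
  add_mem' {x y} hx hy := by
    simp only [Set.mem_setOf_eq] at *
    rw [Tri.add_a, hx, hy, add_zero]
  zero_mem' := rfl
  smul_mem' r x hx := by
    simp only [Set.mem_setOf_eq] at *
    show (x * r.unop).a = 0
    rw [Tri.mul_a, hx, zero_mul]

/-- The copy of `S̄` inside `Q`, a submodule of the right `Ã`-module `Q`. -/
def SbarPart : Submodule (AsymCover A S)ᵐᵒᵖ ↥(Qsub A S) where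
  carrier := {x | (x : AsymCover A S).b = 0}
  add_mem' {x y} hx hy := by
    simp only [Set.mem_setOf_eq] at *
    rw [Submodule.coe_add, Tri.add_b, hx, hy, add_zero]
  zero_mem' := rfl
  smul_mem' r x hx := by
    simp only [Set.mem_setOf_eq] at *
    show ((x : AsymCover A S) * r.unop).b = 0
    rw [Tri.mul_b, hx, zero_mul]

/-- The projection `Ã → A` onto the `(1,1)`-corner, as a ring homomorphism. -/
def triProjA : AsymCover A S →+* A where
  toFun x := x.a
  map_one' := rfl
  map_mul' _ _ := rfl
  map_zero' := rfl
  map_add' _ _ := rfl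

/-- The projection `Ã → Ā` onto the `(2,2)`-corner, as a ring homomorphism. -/
def triProjB : AsymCover A S →+* Abar A S where
  toFun x := x.b
  map_one' := rfl
  map_mul' _ _ := rfl
  map_zero' := rfl
  map_add' _ _ := rfl

/-- Each simple right `A`-module `S i` is a (simple) right `Ã`-module via the
projection `Ã → A`. -/
noncomputable instance instModuleAsymS (i : ι) : Module (AsymCover A S)ᵐᵒᵖ (S i) :=
  Module.compHom (S i) (RingHom.op (triProjA A S))

/-- The square-zero ideal `End_A(S i)^♮` of `T(End_A(S i))`, identified with
`End_A(S i)`, is a (simple) right `Ã`-module: the cover `Ã` acts through the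
ring homomorphism `Ã → T(End_A(S i)) → End_A(S i)` and right multiplication. -/
noncomputable instance instModuleAsymNat (i : ι) : Module (AsymCover A S)ᵐᵒᵖ (EndS A S i) :=
  Module.compHom (EndS A S i)
    (RingHom.op ((tszeFst (EndS A S i)).comp ((Pi.evalRingHom _ i).comp (triProjB A S))))

/-- An element that is a multiple of each of its own nonzero multiples lies in the socle. -/
lemma mem_moduleSoc_of_forall_exists_smul {R M : Type u} [Ring R] [AddCommGroup M] [Module R M]
    (x : M) (h : ∀ r : R, r • x ≠ 0 → ∃ t : R, t • r • x = x) : x ∈ moduleSoc R M := by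
  by_cases hx : x = 0
  · rw [hx]
    exact zero_mem _
  have hsimple : IsSimpleModule R (Submodule.span R {x}) := by
    rw [isSimpleModule_iff_isAtom]
    refine ⟨by simpa using hx, fun N hN => ?_⟩
    by_contra hne
    obtain ⟨y, hy, hy0⟩ := Submodule.exists_mem_ne_zero_of_ne_bot hne
    obtain ⟨r, rfl⟩ := Submodule.mem_span_singleton.1 (hN.le hy)
    obtain ⟨t, ht⟩ := h r hy0
    refine hN.not_ge ((Submodule.span_singleton_le_iff_mem _ _).2 ?_)
    rw [← ht]
    exact N.smul_mem _ hy
  exact (le_sSup (show Submodule.span R {x} ∈ {N : Submodule R M | IsSimpleModule R ↥N} from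
    hsimple)) (Submodule.mem_span_singleton_self x)

/-- A submodule that meets every nonzero cyclic submodule nontrivially contains the socle. -/
lemma moduleSoc_le_of_forall_exists_smul {R M : Type u} [Ring R] [AddCommGroup M] [Module R M]
    (X : Submodule R M) (h : ∀ x : M, x ≠ 0 → ∃ r : R, r • x ∈ X ∧ r • x ≠ 0) :
    moduleSoc R M ≤ X := by
  refine sSup_le fun N hN => ?_
  have hatom : IsAtom N := isSimpleModule_iff_isAtom.1 hN
  obtain ⟨x, hx, hx0⟩ := Submodule.exists_mem_ne_zero_of_ne_bot hatom.1
  obtain ⟨r, hr, hr0⟩ := h x hx0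
  refine inf_eq_left.1 ((hatom.le_iff.1 (inf_le_left : N ⊓ X ≤ N)).resolve_left fun hbot => ?_)
  exact hr0 ((Submodule.mem_bot R).1 (hbot ▸ ⟨N.smul_mem r hx, hr⟩))

/-- Schur's lemma, in the form: a nonzero composite `e * f` can be multiplied back to `e`. -/
lemma exists_mul_mul_eq_of_isSimpleModule {R M : Type u} [Ring R] [AddCommGroup M] [Module R M]
    [IsSimpleModule R M] (e f : Module.End R M) (h : e * f ≠ 0) :
    ∃ g : Module.End R M, e * f * g = e := by
  have hf : f ≠ 0 := fun h0 => h (by rw [h0, mul_zero])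
  have hbij := (LinearMap.bijective_or_eq_zero f).resolve_right hf
  refine ⟨(LinearEquiv.ofBijective f hbij).symm, ?_⟩
  ext x
  exact congrArg e ((LinearEquiv.ofBijective f hbij).apply_symm_apply x)

/-- In a simple module every element is a multiple of any nonzero one. -/
lemma exists_smul_eq_of_isSimpleModule {R M : Type u} [Ring R] [AddCommGroup M] [Module R M]
    [IsSimpleModule R M] {x : M} (hx : x ≠ 0) (y : M) : ∃ r : R, r • x = y :=
  IsSimpleModule.toSpanSingleton_surjective R hx y

/-- The right ideal `⨁ i, End_A(S i)^♮` of `Ā`. -/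
def natPart : Submodule (Abar A S)ᵐᵒᵖ (Abar A S) where
  carrier := {b | ∃ z : Π₀ i, EndS A S i, ∀ i, b i = TrivSqZeroExt.inr (z i)}
  add_mem' := by
    rintro b c ⟨z, hz⟩ ⟨w, hw⟩
    exact ⟨z + w, fun i => by
      rw [Pi.add_apply, hz, hw, DFinsupp.add_apply, TrivSqZeroExt.inr_add]⟩
  zero_mem' := ⟨0, fun i => by simp⟩
  smul_mem' := by
    rintro r b ⟨z, hz⟩
    refine ⟨z.mapRange (fun i e => e * (r.unop i).fst) (fun i => zero_mul _), fun i => ?_⟩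
    change b i * r.unop i = _
    rw [hz, DFinsupp.mapRange_apply]
    ext <;> simp

variable {A S}

open Classical in
lemma natPart_induction {p : Abar A S → Prop} (zero : p 0)
    (add : ∀ b c, p b → p c → p (b + c))
    (single : ∀ i (e : EndS A S i), p (Pi.single i (TrivSqZeroExt.inr e)))
    {b : Abar A S} (hb : b ∈ natPart A S) : p b := by
  obtain ⟨z, hz⟩ := hb
  obtain rfl : b = fun i => TrivSqZeroExt.inr (z i) := funext hz
  clear hz
  induction z using DFinsupp.induction with
  | h0 => exact zero
  | ha i e z _ _ ih =>
    convert add _ _ (single i e) ih using 1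
    funext j
    rw [DFinsupp.add_apply, TrivSqZeroExt.inr_add, Pi.add_apply]
    congr 1
    by_cases h : j = i
    · subst h
      simp
    · rw [DFinsupp.single_eq_of_ne h, Pi.single_eq_of_ne h, TrivSqZeroExt.inr_zero]

open Classical in
lemma single_mem_natPart (i : ι) (e : EndS A S i) :
    (Pi.single i (TrivSqZeroExt.inr e) : Abar A S) ∈ natPart A S := by
  refine ⟨DFinsupp.single i e, fun j => ?_⟩
  by_cases h : j = i
  · subst h
    simp
  · rw [DFinsupp.single_eq_of_ne h, Pi.single_eq_of_ne h, TrivSqZeroExt.inr_zero]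

open Classical in
lemma single_inr_mul (i : ι) (e : EndS A S i) (r : Abar A S) :
    (Pi.single i (TrivSqZeroExt.inr e) : Abar A S) * r
      = Pi.single i (TrivSqZeroExt.inr (e * (r i).fst)) := by
  rw [← Pi.single_mul_left]
  congr 1
  ext <;> simp

open Classical in
lemma exists_single_inr_mul_mul_eq (hS : ∀ i, IsSimpleModule Aᵐᵒᵖ (S i)) (i : ι)
    (e : EndS A S i) (r : Abar A S)
    (h : (Pi.single i (TrivSqZeroExt.inr e) : Abar A S) * r ≠ 0) :
    ∃ t : Abar A S, (Pi.single i (TrivSqZeroExt.inr e) : Abar A S) * r * t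
      = Pi.single i (TrivSqZeroExt.inr e) := by
  have := hS i
  have hne : e * (r i).fst ≠ 0 := by
    intro h0
    rw [single_inr_mul, h0, TrivSqZeroExt.inr_zero, Pi.single_zero] at h
    exact h rfl
  obtain ⟨g, hg⟩ := exists_mul_mul_eq_of_isSimpleModule e _ hne
  refine ⟨Pi.single i (TrivSqZeroExt.inl g), ?_⟩
  rw [single_inr_mul, single_inr_mul, Pi.single_eq_same, TrivSqZeroExt.fst_inl, hg]

open Classical in
lemma moduleSoc_abar (hS : ∀ i, IsSimpleModule Aᵐᵒᵖ (S i)) :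
    moduleSoc (Abar A S)ᵐᵒᵖ (Abar A S) = natPart A S := by
  refine le_antisymm (moduleSoc_le_of_forall_exists_smul _ fun b hb => ?_) fun b hb => ?_
  · by_cases hfst : ∃ i, (b i).fst ≠ 0
    · obtain ⟨i, hi⟩ := hfst
      have hmul : b * Pi.single i (TrivSqZeroExt.inr 1)
          = Pi.single i (TrivSqZeroExt.inr (b i).fst) := by
        rw [← Pi.single_mul_right]
        congr 1
        ext <;> simp
      refine ⟨op (Pi.single i (TrivSqZeroExt.inr 1)), ?_, ?_⟩
      · rw [op_smul_eq_mul, hmul]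
        exact single_mem_natPart i _
      · rw [op_smul_eq_mul, hmul, Ne, Pi.single_eq_zero_iff]
        exact fun h => hi (by simpa using congrArg TrivSqZeroExt.snd h)
    · push Not at hfst
      obtain ⟨i, hi⟩ := Function.ne_iff.1 hb
      have hbi : b i = TrivSqZeroExt.inr (b i).snd := by ext <;> simp [hfst]
      refine ⟨op (Pi.single i 1), ?_, ?_⟩
      · rw [op_smul_eq_mul, ← Pi.single_mul_right, mul_one, hbi]
        exact single_mem_natPart i _
      · rw [op_smul_eq_mul, ← Pi.single_mul_right, mul_one, Ne, Pi.single_eq_zero_iff]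
        exact hi
  · refine natPart_induction (zero_mem _) (fun b c hb hc => add_mem hb hc) (fun i e => ?_) hb
    refine mem_moduleSoc_of_forall_exists_smul _ fun r hr => ?_
    obtain ⟨t, ht⟩ := exists_single_inr_mul_mul_eq hS i e r.unop hr
    exact ⟨op t, ht⟩

lemma sbar_smul_apply (b : Abar A S) (m : Sbar A S) (i : ι) : (b • m) i = (b i).fst (m i) :=
  rfl

lemma smul_eq_zero_of_mem_natPart {b : Abar A S} (hb : b ∈ natPart A S) (m : Sbar A S) :
    b • m = 0 := by
  obtain ⟨z, hz⟩ := hb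
  refine DFinsupp.ext fun i => ?_
  rw [sbar_smul_apply, hz]
  rfl

variable (A S)

/-- The inclusion of `S̄ ⊕ Ā` into the asymmetric cover, with image `Q`. -/
def qMk (m : Sbar A S) (b : Abar A S) : ↥(Qsub A S) := ⟨⟨0, m, b⟩, rfl⟩

/-- The elements of `Q` whose `Ā`-component lies in `⨁ i, End_A(S i)^♮`. -/
def qSoc : Submodule (AsymCover A S)ᵐᵒᵖ ↥(Qsub A S) where
  carrier := {x | (x : AsymCover A S).b ∈ natPart A S}
  add_mem' {x y} hx hy := (natPart A S).add_mem hx hy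
  zero_mem' := zero_mem (natPart A S)
  smul_mem' r _ hx := (natPart A S).smul_mem (op r.unop.b) hx

/-- The copy of `soc Ā` inside `Q`. -/
def qNat : Submodule (AsymCover A S)ᵐᵒᵖ ↥(Qsub A S) where
  carrier := {x | (x : AsymCover A S).m = 0 ∧ (x : AsymCover A S).b ∈ natPart A S}
  add_mem' {x y} hx hy := by
    refine ⟨?_, add_mem hx.2 hy.2⟩
    rw [Submodule.coe_add, Tri.add_m, hx.1, hy.1, add_zero]
  zero_mem' := ⟨rfl, zero_mem (natPart A S)⟩
  smul_mem' r x hx := by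
    refine ⟨?_, (natPart A S).smul_mem (op r.unop.b) hx.2⟩
    change op r.unop.a • (x : AsymCover A S).m + (x : AsymCover A S).b • r.unop.m = 0
    rw [hx.1, smul_zero, zero_add, smul_eq_zero_of_mem_natPart hx.2]

variable {A S}

lemma op_smul_qMk (r : AsymCover A S) (m : Sbar A S) (b : Abar A S) :
    op r • qMk A S m b = qMk A S (op r.a • m + b • r.m) (b * r.b) :=
  Subtype.ext (Tri.ext (zero_mul _) rfl rfl)

lemma qMk_add (m n : Sbar A S) (b c : Abar A S) :
    qMk A S (m + n) (b + c) = qMk A S m b + qMk A S n c :=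
  Subtype.ext (Tri.ext (add_zero _).symm rfl rfl)

lemma qMk_self (x : ↥(Qsub A S)) :
    qMk A S (x : AsymCover A S).m (x : AsymCover A S).b = x :=
  Subtype.ext (Tri.ext (Eq.symm x.2) rfl rfl)

lemma qMk_eq_zero_iff {m : Sbar A S} {b : Abar A S} : qMk A S m b = 0 ↔ m = 0 ∧ b = 0 := by
  refine ⟨fun h => ⟨congrArg (fun x : ↥(Qsub A S) => (x : AsymCover A S).m) h,
    congrArg (fun x : ↥(Qsub A S) => (x : AsymCover A S).b) h⟩, ?_⟩
  rintro ⟨rfl, rfl⟩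
  rfl

open Classical in
lemma qMk_left_mem_moduleSoc (hS : ∀ i, IsSimpleModule Aᵐᵒᵖ (S i)) (m : Sbar A S) :
    qMk A S m 0 ∈ moduleSoc (AsymCover A S)ᵐᵒᵖ ↥(Qsub A S) := by
  induction m using DirectSum.induction_on with
  | zero => exact zero_mem _
  | add m n hm hn =>
    rw [← add_zero (0 : Abar A S), qMk_add]
    exact add_mem hm hn
  | of i s =>
    have := hS i
    refine mem_moduleSoc_of_forall_exists_smul _ fun r hr => ?_
    have key (a : Aᵐᵒᵖ) (s : S i) : a • (DirectSum.of S i s) = DirectSum.of S i (a • s) :=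
      ((DirectSum.lof Aᵐᵒᵖ ι S i).map_smul a s).symm
    induction r using MulOpposite.rec' with | _ r =>
    rw [op_smul_qMk, zero_smul, add_zero, zero_mul, key] at hr ⊢
    have hne : op r.a • s ≠ 0 := fun h0 => hr (by rw [h0, map_zero]; rfl)
    obtain ⟨t, ht⟩ := exists_smul_eq_of_isSimpleModule (R := Aᵐᵒᵖ) hne s
    refine ⟨op ⟨t.unop, 0, 0⟩, ?_⟩
    rw [op_smul_qMk, zero_smul, add_zero, zero_mul, key]
    exact congrArg (fun s => qMk A S (DirectSum.of S i s) 0) ht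

open Classical in
lemma qMk_right_mem_moduleSoc (hS : ∀ i, IsSimpleModule Aᵐᵒᵖ (S i)) {b : Abar A S}
    (hb : b ∈ natPart A S) :
    qMk A S 0 b ∈ moduleSoc (AsymCover A S)ᵐᵒᵖ ↥(Qsub A S) := by
  refine natPart_induction (p := fun b => qMk A S 0 b ∈ moduleSoc _ _) (zero_mem _)
    (fun b c hb hc => ?_) (fun i e => ?_) hb
  · rw [← add_zero (0 : Sbar A S), qMk_add]
    exact add_mem hb hc
  · refine mem_moduleSoc_of_forall_exists_smul _ fun r hr => ?_
    induction r using MulOpposite.rec' with | _ r =>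
    have hzero (c : Abar A S) (m : Sbar A S) :
        ((Pi.single i (TrivSqZeroExt.inr e) : Abar A S) * c) • m = 0 :=
      smul_eq_zero_of_mem_natPart
        ((natPart A S).smul_mem (op c) (single_mem_natPart i e)) m
    rw [op_smul_qMk, smul_zero, zero_add,
      smul_eq_zero_of_mem_natPart (single_mem_natPart i e)] at hr ⊢
    obtain ⟨t, ht⟩ := exists_single_inr_mul_mul_eq hS i e r.b
      fun h0 => hr (by rw [h0]; rfl)
    refine ⟨op ⟨0, 0, t⟩, ?_⟩
    rw [op_smul_qMk, smul_zero, smul_zero, zero_add, ht]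

open Classical in
lemma moduleSoc_qsub (hS : ∀ i, IsSimpleModule Aᵐᵒᵖ (S i)) :
    moduleSoc (AsymCover A S)ᵐᵒᵖ ↥(Qsub A S) = qSoc A S := by
  refine le_antisymm (moduleSoc_le_of_forall_exists_smul _ fun x hx => ?_) fun x hx => ?_
  · rw [← qMk_self x] at hx ⊢
    generalize (x : AsymCover A S).m = m at hx ⊢
    generalize (x : AsymCover A S).b = b at hx ⊢
    by_cases hfst : ∃ i, (b i).fst ≠ 0
    · obtain ⟨i, hi⟩ := hfst
      obtain ⟨s, hs⟩ := DFunLike.ne_iff.1 hi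
      refine ⟨op ⟨0, DirectSum.of S i s, 0⟩, ?_, ?_⟩
      · rw [op_smul_qMk, mul_zero]
        exact zero_mem (natPart A S)
      · rw [op_smul_qMk, op_zero, zero_smul, zero_add]
        intro h0
        have h1 := congrArg (fun m : Sbar A S => m i) (qMk_eq_zero_iff.1 h0).1
        simp only [sbar_smul_apply, DirectSum.of_eq_same] at h1
        exact hs h1
    · push Not at hfst
      by_cases hb : b = 0
      · exact ⟨1, by rw [one_smul, hb]; exact zero_mem (natPart A S), by rwa [one_smul]⟩
      obtain ⟨i, hi⟩ := Function.ne_iff.1 hb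
      have hbi : b i = TrivSqZeroExt.inr (b i).snd := by ext <;> simp [hfst]
      refine ⟨op ⟨0, 0, Pi.single i 1⟩, ?_, ?_⟩
      · rw [op_smul_qMk, ← Pi.single_mul_right, mul_one, hbi]
        exact single_mem_natPart i _
      · rw [op_smul_qMk, ← Pi.single_mul_right, mul_one, Ne, qMk_eq_zero_iff,
          Pi.single_eq_zero_iff]
        exact fun h => hi h.2
  · rw [← qMk_self x, ← add_zero (x : AsymCover A S).m, ← zero_add (x : AsymCover A S).b, qMk_add]
    exact add_mem (qMk_left_mem_moduleSoc hS _) (qMk_right_mem_moduleSoc hS hx)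

variable (A S)

/-- The embedding of `⨁ i, (S i ⊕ End_A(S i)^♮)` into `Q`. -/
noncomputable def directSumToQ : (⨁ i, (S i × EndS A S i)) →ₗ[(AsymCover A S)ᵐᵒᵖ] ↥(Qsub A S) where
  toFun x := qMk A S (DFinsupp.mapRange (fun _ p => p.1) (fun _ => rfl) x)
    fun i => TrivSqZeroExt.inr (x i).2
  map_add' x y := by
    rw [← qMk_add]
    congr 1
    · exact DFinsupp.ext fun i => rfl
    · funext i
      exact TrivSqZeroExt.inr_add _ _ _
  map_smul' r x := by
    induction r using MulOpposite.rec' with | _ r =>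
    rw [RingHom.id_apply, op_smul_qMk]
    congr 1
    · refine DFinsupp.ext fun i => ?_
      exact (add_zero _).symm
    · funext i
      change TrivSqZeroExt.inr ((x i).2 * (r.b i).fst) = TrivSqZeroExt.inr (x i).2 * r.b i
      ext <;> simp

lemma directSumToQ_injective : Function.Injective (directSumToQ A S) := by
  refine (injective_iff_map_eq_zero _).2 fun x hx => ?_
  obtain ⟨hm, hb⟩ := qMk_eq_zero_iff.1 hx
  refine DFinsupp.ext fun i => Prod.ext ?_ ?_
  · exact congrArg (fun m : Sbar A S => m i) hm
  · exact congrArg (fun b : Abar A S => (b i).snd) hb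

lemma range_directSumToQ : LinearMap.range (directSumToQ A S) = qSoc A S := by
  ext x
  constructor
  · rintro ⟨y, rfl⟩
    exact ⟨DFinsupp.mapRange (fun _ p => p.2) (fun _ => rfl) y, fun i => rfl⟩
  · rintro ⟨z, hz⟩
    refine ⟨DFinsupp.zipWith (fun _ s e => (s, e)) (fun _ => rfl) (x : AsymCover A S).m z, ?_⟩
    rw [← qMk_self x]
    change qMk A S _ _ = _
    congr 1
    · exact DFinsupp.ext fun i => rfl
    · funext i
      exact (hz i).symm

/-- The socle of the right `Ã`-module `Q = fÃ` decomposes as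
`soc Q = S̄ ⊕ soc Ā`, and it is isomorphic, as a right `Ã`-module, to the
direct sum over `i` of `S i ⊕ End_A(S i)^♮`. -/
theorem soc_of_Q_decomposition (hfam : IsSimpleFamily A S) :
    (∃ N : Submodule (AsymCover A S)ᵐᵒᵖ ↥(Qsub A S),
      (∀ x : ↥(Qsub A S), x ∈ N ↔ ((x : AsymCover A S).m = 0 ∧
        (x : AsymCover A S).b ∈ moduleSoc (Abar A S)ᵐᵒᵖ (Abar A S))) ∧
      moduleSoc (AsymCover A S)ᵐᵒᵖ ↥(Qsub A S) = SbarPart A S ⊔ N ∧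
      Disjoint (SbarPart A S) N) ∧
    Nonempty ((↥(moduleSoc (AsymCover A S)ᵐᵒᵖ ↥(Qsub A S))) ≃ₗ[(AsymCover A S)ᵐᵒᵖ]
      ⨁ i, (S i × EndS A S i)) := by
  have hsoc := moduleSoc_qsub hfam.1
  refine ⟨⟨qNat A S, fun x => ?_, ?_, ?_⟩, ⟨?_⟩⟩
  · rw [moduleSoc_abar hfam.1]
    rfl
  · rw [hsoc]
    refine le_antisymm (fun x hx => ?_) (sup_le (fun x hx => ?_) fun x hx => hx.2)
    · rw [← qMk_self x, ← add_zero (x : AsymCover A S).m, ← zero_add (x : AsymCover A S).b,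
        qMk_add]
      exact Submodule.add_mem_sup (show _ = _ from rfl) ⟨rfl, hx⟩
    · change (x : AsymCover A S).b ∈ natPart A S
      rw [show (x : AsymCover A S).b = 0 from hx]
      exact zero_mem _
  · refine Submodule.disjoint_def.2 fun x hx hx' => ?_
    rw [← qMk_self x]
    exact qMk_eq_zero_iff.2 ⟨hx'.1, hx⟩
  · exact ((LinearEquiv.ofInjective _ (directSumToQ_injective A S)).trans
      (LinearEquiv.ofEq _ _ ((range_directSumToQ A S).trans hsoc.symm))).symm

end Statement2
end

section
/- For a ring A, the small finitistic dimension fin.dim A equals 0 if and only if every monomorphism between finitely generated projective right A-modules splits. -/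
set_option linter.unusedSectionVars false
set_option synthInstance.maxHeartbeats 1000000
set_option maxHeartbeats 1600000
set_option linter.unusedVariables false
set_option linter.unnecessarySeqFocus false

universe u
open MulOpposite Function DirectSum

section
variable {R : Type u} [Ring R] {M : Type u} [AddCommGroup M] [Module R M]

lemma projDim_eq_zero_iff : projDim R M = 0 ↔ Module.Projective R M := by
  refine ⟨fun h => ?_, fun h => le_antisymm (sInf_le ⟨0, rfl, h⟩) zero_le⟩
  have hne : {d : ℕ∞ | ∃ n : ℕ, d = n ∧ pdLE R n M}.Nonempty := by
    by_contra hempty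
    rw [projDim, Set.not_nonempty_iff_eq_empty.mp hempty, sInf_empty] at h
    exact ENat.top_ne_zero h
  obtain ⟨n, hn, hpd⟩ := csInf_mem hne
  obtain rfl : n = 0 := by
    rw [projDim] at h
    exact_mod_cast hn.symm.trans h
  exact hpd

lemma smallFinDimLeft_eq_zero_iff : smallFinDimLeft R = 0 ↔
    ∀ (M : Type u) (_ : AddCommGroup M) (_ : Module R M) (n : ℕ),
      fgpdLE R n M → Module.Projective R M := by
  rw [smallFinDimLeft, ← bot_eq_zero, sSup_eq_bot]
  constructor
  · intro h M _ _ n hn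
    exact projDim_eq_zero_iff.mp (h _ ⟨M, _, _, ⟨n, hn⟩, rfl⟩)
  · rintro h _ ⟨M, _, _, ⟨n, hn⟩, rfl⟩
    exact projDim_eq_zero_iff.mpr (h M _ _ n hn)

lemma fgpdLE_one_quotient_range {P Q : Type u} [AddCommGroup P] [Module R P]
    [AddCommGroup Q] [Module R Q] [Module.Projective R P] [Module.Finite R P]
    [Module.Projective R Q] [Module.Finite R Q] {f : P →ₗ[R] Q} (hf : Function.Injective f) :
    fgpdLE R 1 (Q ⧸ LinearMap.range f) := by
  let e : P ≃ₗ[R] LinearMap.ker (LinearMap.range f).mkQ :=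
    (LinearEquiv.ofInjective f hf).trans (LinearEquiv.ofEq _ _ (Submodule.ker_mkQ _).symm)
  exact ⟨Q, _, _, ⟨inferInstance, inferInstance⟩, _, Submodule.mkQ_surjective _,
    Module.Projective.of_equiv e, Module.Finite.equiv e⟩

lemma projective_and_finite_of_fgpdLE
    (hsplit : ∀ (P Q : Type u) (_ : AddCommGroup P) (_ : Module R P)
      (_ : AddCommGroup Q) (_ : Module R Q),
      Module.Projective R P → Module.Finite R P → Module.Projective R Q → Module.Finite R Q →
      ∀ f : P →ₗ[R] Q, Function.Injective f → ∃ g : Q →ₗ[R] P, g.comp f = LinearMap.id)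
    {n : ℕ} (h : fgpdLE R n M) : Module.Projective R M ∧ Module.Finite R M := by
  induction n generalizing M with
  | zero => exact h
  | succ n ih =>
    obtain ⟨P, _, _, ⟨_, _⟩, f, hf, hker⟩ := h
    obtain ⟨_, _⟩ := ih hker
    have hinj := (LinearMap.ker f).injective_subtype
    obtain ⟨s, hs⟩ := ((LinearMap.exact_subtype_ker_map f).split_tfae hinj hf).out 1 0 |>.mp
      (hsplit _ P _ _ _ _ ‹_› ‹_› ‹_› ‹_› _ hinj)
    exact ⟨Module.Projective.of_split s f hs, Module.Finite.of_surjective f hf⟩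

end

/-- For a ring `A`, the small finitistic dimension of `A`
(computed with right `A`-modules) is zero if and only if every monomorphism
between finitely generated projective right `A`-modules splits. -/
theorem finDim_eq_zero_iff_mono_splits (A : Type u) [Ring A] :
    finDim A = 0 ↔
      ∀ (P Q : Type u) (_ : AddCommGroup P) (_ : Module Aᵐᵒᵖ P)
        (_ : AddCommGroup Q) (_ : Module Aᵐᵒᵖ Q),
        Module.Projective Aᵐᵒᵖ P → Module.Finite Aᵐᵒᵖ P →
        Module.Projective Aᵐᵒᵖ Q → Module.Finite Aᵐᵒᵖ Q →
        ∀ f : P →ₗ[Aᵐᵒᵖ] Q, Function.Injective f →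
          ∃ g : Q →ₗ[Aᵐᵒᵖ] P, g.comp f = LinearMap.id := by
  rw [finDim, smallFinDimLeft_eq_zero_iff]
  constructor
  · intro h P Q _ _ _ _ _ _ _ _ f hf
    have := h _ _ _ 1 (fgpdLE_one_quotient_range hf)
    have hsurj := Submodule.mkQ_surjective (LinearMap.range f)
    exact ((LinearMap.exact_map_mkQ_range f).split_tfae hf hsurj).out 0 1 |>.mp
      (LinearMap.exists_rightInverse_of_surjective _ (LinearMap.range_eq_top.mpr hsurj))
  · intro h M _ _ n hn
    exact (projective_and_finite_of_fgpdLE h hn).1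
end

section
/- For any ring A and its asymmetric cover Ã = [[A,0],[S̄,Ā]], the small finitistic dimensions satisfy fin.dim Ã ≥ fin.dim A. -/
set_option linter.unusedSectionVars false
set_option synthInstance.maxHeartbeats 1000000
set_option maxHeartbeats 1600000
set_option linter.unusedVariables false
set_option linter.unnecessarySeqFocus false

universe u
open MulOpposite Function DirectSum

/-! ### Basic facts on projective dimension -/

section ProjectiveDimension

open CategoryTheory

variable {R : Type u} [Ring R]

/-- Having projective dimension at most `n`, in the `Ext`-theoretic sense of Mathlib. -/
abbrev HasPdLE (R : Type u) [Ring R] (M : Type u) [AddCommGroup M] [Module R M] (n : ℕ) : Prop :=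
  HasProjectiveDimensionLE (ModuleCat.of R M) n

lemma hasPdLE_zero_iff (M : Type u) [AddCommGroup M] [Module R M] :
    HasPdLE R M 0 ↔ Module.Projective R M :=
  (projective_iff_hasProjectiveDimensionLE_zero _).symm.trans (IsProjective.iff_projective M).symm

lemma HasPdLE.of_equiv {M N : Type u} [AddCommGroup M] [Module R M] [AddCommGroup N] [Module R N]
    {n : ℕ} (h : HasPdLE R M n) (e : M ≃ₗ[R] N) : HasPdLE R N n :=
  have := h
  hasProjectiveDimensionLT_of_iso e.toModuleIso (n + 1)

lemma hasPdLE_succ_iff_ker {P M : Type u} [AddCommGroup P] [Module R P] [AddCommGroup M]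
    [Module R M] [Module.Projective R P] {f : P →ₗ[R] M} (hf : Surjective f) (n : ℕ) :
    HasPdLE R M (n + 1) ↔ HasPdLE R (LinearMap.ker f) n :=
  (LinearMap.shortExact_shortComplexKer hf).hasProjectiveDimensionLT_X₃_iff n
    ((IsProjective.iff_projective P).mp inferInstance)

lemma pdLE.hasPdLE : ∀ {n : ℕ} {M : Type u} [AddCommGroup M] [Module R M],
    pdLE R n M → HasPdLE R M n
  | 0, M, _, _, h => (hasPdLE_zero_iff M).mpr h
  | n + 1, _, _, _, ⟨_, _, _, _, _, hf, hker⟩ => (hasPdLE_succ_iff_ker hf n).mpr hker.hasPdLE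

end ProjectiveDimension

lemma fgpdLE.of_equiv {R : Type u} [Ring R] {M N : Type u} [AddCommGroup M] [Module R M]
    [AddCommGroup N] [Module R N] : ∀ {n : ℕ}, fgpdLE R n M → (M ≃ₗ[R] N) → fgpdLE R n N
  | 0, ⟨_, _⟩, e => ⟨Module.Projective.of_equiv e, Module.Finite.equiv e⟩
  | n + 1, ⟨P, _, _, hP, f, hf, hker⟩, e => by
    refine ⟨P, _, _, hP, e.toLinearMap ∘ₗ f, e.surjective.comp hf, ?_⟩
    rwa [LinearEquiv.ker_comp]

/-! ### Change of rings along a ring map with a linear section -/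

section ChangeOfRings

variable {R T : Type u} [Ring R] [Ring T] [Module R T] [IsScalarTower R T T]

/-- The kernel of a map is unchanged by restriction of scalars. -/
def kerRestrictScalarsEquiv {P M : Type u} [AddCommGroup P] [Module T P] [Module R P]
    [IsScalarTower R T P] [AddCommGroup M] [Module T M] [Module R M] [IsScalarTower R T M]
    (f : P →ₗ[T] M) : LinearMap.ker f ≃ₗ[R] LinearMap.ker (f.restrictScalars R) where
  toFun x := ⟨x.1, x.2⟩
  invFun x := ⟨x.1, x.2⟩
  map_add' _ _ := rfl
  map_smul' _ _ := rfl

/-- Restriction of scalars along `r ↦ r • 1`. -/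
abbrev restrictModule (R : Type u) {T : Type u} [Ring R] [Ring T] [Module R T]
    [IsScalarTower R T T] (M : Type u) [AddCommGroup M] [Module T M] : Module R M :=
  Module.compHom M (RingHom.smulOneHom : R →+* T)

lemma isScalarTower_restrictModule (M : Type u) [AddCommGroup M] [Module T M] :
    letI := restrictModule R (T := T) M
    IsScalarTower R T M :=
  letI := restrictModule R (T := T) M
  ⟨fun r t m => by
    change (r • t) • m = (r • (1 : T)) • t • m
    rw [smul_smul, smul_mul_assoc, one_mul]⟩

lemma section_smul {s : T →ₗ[R] R} (hs : ∀ t, s t • (1 : T) = t)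
    {M : Type u} [AddCommGroup M] [Module T M] [Module R M] [IsScalarTower R T M]
    (t : T) (m : M) : s t • m = t • m := by
  conv_lhs => rw [← one_smul T m, ← smul_assoc, hs]

lemma Module.Projective.restrictScalars_of_section {s : T →ₗ[R] R} (hs : ∀ t, s t • (1 : T) = t)
    (P : Type u) [AddCommGroup P] [Module T P] [Module R P] [IsScalarTower R T P]
    [Module.Projective T P] : Module.Projective R P := by
  obtain ⟨σ, hσ⟩ := Module.projective_def'.mp ‹Module.Projective T P›
  refine Module.projective_def'.mpr
    ⟨Finsupp.mapRange.linearMap s ∘ₗ σ.restrictScalars R, LinearMap.ext fun x => ?_⟩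
  refine Eq.trans ?_ (LinearMap.congr_fun hσ x)
  simp only [LinearMap.comp_apply, LinearMap.restrictScalars_apply, Finsupp.mapRange.linearMap_apply,
    Finsupp.linearCombination_apply]
  rw [Finsupp.sum_mapRange_index (by simp)]
  simp only [section_smul hs]

lemma Module.Projective.of_restrictScalars_of_section {s : T →ₗ[R] R} (hs : ∀ t, s t • (1 : T) = t)
    (P : Type u) [AddCommGroup P] [Module T P] [Module R P] [IsScalarTower R T P]
    [Module.Projective R P] : Module.Projective T P := by
  obtain ⟨τ, hτ⟩ := Module.projective_lifting_property
    ((Finsupp.linearCombination T (id : P → P)).restrictScalars R) LinearMap.id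
    (Finsupp.linearCombination_id_surjective T P)
  refine ⟨⟨{ toFun := τ, map_add' := τ.map_add, map_smul' := fun t x => ?_ },
    LinearMap.congr_fun hτ⟩⟩
  rw [← section_smul hs, map_smul, section_smul hs, RingHom.id_apply]

lemma Module.Finite.restrictScalars_of_section {s : T →ₗ[R] R} (hs : ∀ t, s t • (1 : T) = t)
    (P : Type u) [AddCommGroup P] [Module T P] [Module R P] [IsScalarTower R T P]
    [Module.Finite T P] : Module.Finite R P := by
  have : Module.Finite R T :=
    .of_surjective (LinearMap.toSpanSingleton R T 1) fun t => ⟨s t, hs t⟩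
  obtain ⟨n, f, hf⟩ := Module.Finite.exists_fin' T P
  exact .of_surjective (f.restrictScalars R) hf

lemma fgpdLE.restrictScalars {s : T →ₗ[R] R} (hs : ∀ t, s t • (1 : T) = t) :
    ∀ {n : ℕ} {M : Type u} [AddCommGroup M] [Module T M] [Module R M]
      [IsScalarTower R T M], fgpdLE T n M → fgpdLE R n M
  | 0, M, _, _, _, _, ⟨_, _⟩ =>
    ⟨.restrictScalars_of_section hs M, .restrictScalars_of_section hs M⟩
  | n + 1, M, _, _, _, _, ⟨P, _, _, ⟨_, _⟩, f, hf, hker⟩ =>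
    letI := restrictModule R (T := T) P
    haveI := isScalarTower_restrictModule (R := R) (T := T) P
    ⟨P, _, _, ⟨.restrictScalars_of_section hs P, .restrictScalars_of_section hs P⟩,
      f.restrictScalars R, hf, (hker.restrictScalars hs).of_equiv (kerRestrictScalarsEquiv f)⟩

lemma HasPdLE.pdLE_of_section {s : T →ₗ[R] R} (hs : ∀ t, s t • (1 : T) = t) :
    ∀ {n : ℕ} {M : Type u} [AddCommGroup M] [Module T M] [Module R M]
      [IsScalarTower R T M], HasPdLE R M n → pdLE T n M
  | 0, M, _, _, _, _, h =>
    have := (hasPdLE_zero_iff M).mp h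
    Module.Projective.of_restrictScalars_of_section hs M
  | n + 1, M, _, _, _, _, h => by
    have := Module.Projective.restrictScalars_of_section hs (M →₀ T)
    let f := Finsupp.linearCombination T (id : M → M)
    have hf : Surjective f := Finsupp.linearCombination_id_surjective T M
    have hker : HasPdLE R (LinearMap.ker f) n :=
      ((hasPdLE_succ_iff_ker (f := f.restrictScalars R) hf n).mp h).of_equiv
        (kerRestrictScalarsEquiv (R := R) f).symm
    exact ⟨M →₀ T, _, _, inferInstance, f, hf, hker.pdLE_of_section hs⟩

lemma projDim_le_projDim_of_section {s : T →ₗ[R] R} (hs : ∀ t, s t • (1 : T) = t)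
    (M : Type u) [AddCommGroup M] [Module T M] [Module R M]
    [IsScalarTower R T M] : projDim T M ≤ projDim R M :=
  sInf_le_sInf fun _ ⟨n, hn, h⟩ => ⟨n, hn, h.hasPdLE.pdLE_of_section hs⟩

theorem smallFinDimLeft_le_of_section {s : T →ₗ[R] R} (hs : ∀ t, s t • (1 : T) = t) :
    smallFinDimLeft T ≤ smallFinDimLeft R := by
  refine sSup_le ?_
  rintro _ ⟨M, _, _, ⟨n, hn⟩, rfl⟩
  let := restrictModule R (T := T) M
  have := isScalarTower_restrictModule (R := R) (T := T) M
  exact (projDim_le_projDim_of_section hs M).trans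
    (le_sSup ⟨M, _, _, ⟨n, hn.restrictScalars hs⟩, rfl⟩)

end ChangeOfRings

/-! ### Finitistic dimension of triangular matrix rings -/

section Triangular

variable (A B M : Type u) [Ring A] [Ring B] [AddCommGroup M]
  [Module B M] [Module Aᵐᵒᵖ M] [SMulCommClass B Aᵐᵒᵖ M]

/-- The projection of a lower triangular matrix ring onto its upper left corner. -/
def Tri.toA : Tri A B M →+* A where
  toFun := Tri.a
  map_one' := rfl
  map_mul' _ _ := rfl
  map_zero' := rfl
  map_add' _ _ := rfl

theorem finDim_le_finDim_tri : finDim A ≤ finDim (Tri A B M) := by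
  let : Module (Tri A B M)ᵐᵒᵖ Aᵐᵒᵖ := Module.compHom Aᵐᵒᵖ (Tri.toA A B M).op
  have : IsScalarTower (Tri A B M)ᵐᵒᵖ Aᵐᵒᵖ Aᵐᵒᵖ := ⟨fun x y z => mul_assoc (op x.unop.a) y z⟩
  let s : Aᵐᵒᵖ →ₗ[(Tri A B M)ᵐᵒᵖ] (Tri A B M)ᵐᵒᵖ :=
    { toFun := fun t => op ⟨t.unop, 0, 0⟩
      map_add' := fun _ _ => unop_injective (by ext <;> simp)
      map_smul' := fun x t => unop_injective (by
        refine Tri.ext rfl ?_ ?_ <;> simp) }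
  exact smallFinDimLeft_le_of_section (s := s) mul_one

end Triangular

/-- For any ring `A` and its asymmetric cover
`Ã = [[A,0],[S̄,Ā]]`, the small finitistic dimensions (computed with right
modules) satisfy `fin.dim Ã ≥ fin.dim A`. -/
theorem finDim_le_finDim_asymCover
    (A : Type u) [Ring A] {ι : Type u} (S : ι → Type u)
    [∀ i, AddCommGroup (S i)] [∀ i, Module Aᵐᵒᵖ (S i)]
    (hfam : IsSimpleFamily A S) :
    finDim A ≤ finDim (AsymCover A S) := by
  exact finDim_le_finDim_tri A (Abar A S) (Sbar A S)
end
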